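/- Let Q be a finite quiver without oriented cycles, let n = (n_x)_{x∈Q0} be a dimension vector and E_x = ℂ^{n_x}. For dimension vectors α, ν write α ≤_Q ν if every representation of Q on a family of spaces of dimension vector ν has a subrepresentation of dimension vector α, and α <_Q ν if in addition α ≠ ν. Then for any subdimension vector α (i.e. α_x ≤ n_x for all x), one has α ≤_Q n if and only if (1) edim_Q(α, n) := Σ_{x∈Q0} α_x(n_x − α_x) − Σ_{a:x→y∈Q1} α_x(n_y − α_y) ≥ 0, and (2) every dimension vector β with β <_Q α satisfies β <_Q n. -/

import Mathlib

open Matrix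

noncomputable section

/-- The standard flag subspace `span(e_1, …, e_j)` of `ℂ^n` (with 0-indexed coordinates,
this is the space of vectors vanishing on all coordinates `≥ j`). -/
def stdFlag (n j : ℕ) : Submodule ℂ (Fin n → ℂ) where
  carrier := {f | ∀ i : Fin n, j ≤ (i : ℕ) → f i = 0}
  add_mem' := by
    intro a b ha hb i hi
    simp only [Pi.add_apply, ha i hi, hb i hi, add_zero]
  zero_mem' := by intro i _; rfl
  smul_mem' := by
    intro c f hf i hi
    simp only [Pi.smul_apply, hf i hi, smul_zero]

/-- A quiver given by source and target maps has no oriented cycles. -/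
def NoCycles {V A : Type} (src tgt : A → V) : Prop :=
  ∀ (k : ℕ) (f : Fin (k + 1) → A),
    (∀ i : Fin k, tgt (f i.castSucc) = src (f i.succ)) →
    tgt (f (Fin.last k)) ≠ src (f 0)

/-- `α ≤_Q n` : every representation of the quiver on the spaces `ℂ^{n_x}` has a
subrepresentation of dimension vector `α`. -/
def HasSubrepOfDim {V A : Type} (src tgt : A → V) (n : V → ℕ) (α : V → ℕ) : Prop :=
  ∀ r : ∀ a : A, (Fin (n (src a)) → ℂ) →ₗ[ℂ] (Fin (n (tgt a)) → ℂ),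
    ∃ S : ∀ x : V, Submodule ℂ (Fin (n x) → ℂ),
      (∀ x : V, Module.finrank ℂ (S x) = α x) ∧
      (∀ a : A, (S (src a)).map (r a) ≤ S (tgt a))

/-- A family `K = (K_x)` of subsets `K_x ⊆ {1,…,n_x}` is `Q`-intersecting for `n` if every
representation of the quiver on the `ℂ^{n_x}` admits a subrepresentation `S` lying in the
Schubert variety indexed by `K` (w.r.t. the standard flags). -/
def IsQIntersecting {V A : Type} (src tgt : A → V) (n : V → ℕ)
    (K : ∀ x : V, Finset (Fin (n x))) : Prop :=
  ∀ r : ∀ a : A, (Fin (n (src a)) → ℂ) →ₗ[ℂ] (Fin (n (tgt a)) → ℂ),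
    ∃ S : ∀ x : V, Submodule ℂ (Fin (n x) → ℂ),
      (∀ x : V, Module.finrank ℂ (S x) = (K x).card) ∧
      (∀ x : V, ∀ j : Fin (K x).card,
        (j : ℕ) + 1 ≤ Module.finrank ℂ
          ((S x ⊓ stdFlag (n x) ((((K x).orderIsoOfFin rfl j : Fin (n x)) : ℕ) + 1) :
            Submodule ℂ (Fin (n x) → ℂ)))) ∧
      (∀ a : A, (S (src a)).map (r a) ≤ S (tgt a))

/-- The expected dimension `edim_{Q,B}(K, n)`. -/
def edimQB {V A : Type} [Fintype V] [Fintype A] (src tgt : A → V) (n : V → ℕ)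
    (K : ∀ x : V, Finset (Fin (n x))) : ℤ :=
  (∑ x : V, ∑ j : Fin (K x).card,
      (((((K x).orderIsoOfFin rfl j : Fin (n x)) : ℕ) : ℤ) - ((j : ℕ) : ℤ))) -
  ∑ a : A, ((K (src a)).card : ℤ) * ((n (tgt a) : ℤ) - ((K (tgt a)).card : ℤ))

/-- Composition `K ∘ L` of a family of subsets with a family of subsets of the index sets. -/
def composeFam {V : Type} {n : V → ℕ} (K : ∀ x : V, Finset (Fin (n x)))
    (L : ∀ x : V, Finset (Fin (K x).card)) : ∀ x : V, Finset (Fin (n x)) :=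
  fun x => (L x).image (fun j => ((K x).orderIsoOfFin rfl j : Fin (n x)))

/-- The moment map for the action of `∏_x U(n_x)` on the representation space of the quiver,
`μ_x(r) = Σ_{b : y→x} r_b r_b^* − Σ_{a : x→y} r_a^* r_a`. -/
def momentMap {V A : Type} [Fintype A] [DecidableEq V] (src tgt : A → V) (n : V → ℕ)
    (r : ∀ a : A, Matrix (Fin (n (tgt a))) (Fin (n (src a))) ℂ) (x : V) :
    Matrix (Fin (n x)) (Fin (n x)) ℂ :=
  (∑ a : A, if h : tgt a = x then
      Matrix.reindex (finCongr (congrArg n h)) (finCongr (congrArg n h)) (r a * (r a)ᴴ)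
    else 0) -
  (∑ a : A, if h : src a = x then
      Matrix.reindex (finCongr (congrArg n h)) (finCongr (congrArg n h)) ((r a)ᴴ * r a)
    else 0)

/-! ### The quiver `Q_{3,3}` with vertices `1,…,6` and arrows `1→3, 2→3, 4→3, 4→5, 4→6`
(0-indexed: `0→2, 1→2, 3→2, 3→4, 3→5`). -/

def q33src : Fin 5 → Fin 6 := ![0, 1, 3, 3, 3]

def q33tgt : Fin 5 → Fin 6 := ![2, 2, 2, 4, 5]

/-- The dimension vector `[p,p,p,q,q,q]` for `Q_{3,3}`. -/
def n33 (p q : ℕ) : Fin 6 → ℕ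
  | ⟨0, _⟩ => p
  | ⟨1, _⟩ => p
  | ⟨2, _⟩ => p
  | ⟨3, _⟩ => q
  | ⟨4, _⟩ => q
  | ⟨5, _⟩ => q

/-- A family of subsets for `Q_{3,3}` built from three subsets of `{1,…,p}` (vertices 1,2,3)
and three subsets of `{1,…,q}` (vertices 4,5,6). -/
def fam6 (p q : ℕ) (K : Fin 3 → Finset (Fin p)) (L : Fin 3 → Finset (Fin q)) :
    ∀ x : Fin 6, Finset (Fin (n33 p q x))
  | ⟨0, _⟩ => K 0
  | ⟨1, _⟩ => K 1
  | ⟨2, _⟩ => K 2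
  | ⟨3, _⟩ => L 0
  | ⟨4, _⟩ => L 1
  | ⟨5, _⟩ => L 2

/-! ### The pseudo-unitary group `U(p,q)` -/

/-- The matrix `η = diag(I_p, −I_q)`. -/
def etaMat (p q : ℕ) : Matrix (Fin (p + q)) (Fin (p + q)) ℂ :=
  Matrix.diagonal fun i => if (i : ℕ) < p then 1 else -1

/-- Membership in `U(p,q) = {g : gᴴ η g = η}`. -/
def InUpq (p q : ℕ) (g : Matrix (Fin (p + q)) (Fin (p + q)) ℂ) : Prop :=
  gᴴ * etaMat p q * g = etaMat p q

/-- The central element `Z = diag(q I_p, −p I_q)`. -/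
def Zmat (p q : ℕ) : Matrix (Fin (p + q)) (Fin (p + q)) ℂ :=
  Matrix.diagonal fun i => if (i : ℕ) < p then (q : ℂ) else -(p : ℂ)

/-- The complex diagonal matrix with entries a real sequence. -/
def Dmat {n : ℕ} (A : Fin n → ℝ) : Matrix (Fin n) (Fin n) ℂ :=
  Matrix.diagonal fun i => (A i : ℂ)

/-- The block-diagonal matrix `u ⊕ v`. -/
def blockDiag {p q : ℕ} (u : Matrix (Fin p) (Fin p) ℂ) (v : Matrix (Fin q) (Fin q) ℂ) :
    Matrix (Fin (p + q)) (Fin (p + q)) ℂ :=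
  Matrix.reindex finSumFinEquiv finSumFinEquiv (Matrix.fromBlocks u 0 0 v)

end

section Field

open scoped IntermediateField.algebraAdjoinAdjoin in
lemma exists_squareZero_lift {s : Set ℂ} (hs : IsTranscendenceBasis ℚ ((↑) : s → ℂ))
    {B : Type} [CommRing B] [Algebra ℚ B] (π : B →ₐ[ℚ] ℂ) (hπ : Function.Surjective π)
    (hker : RingHom.ker (π : B →+* ℂ) ^ 2 = ⊥) (f : s → B) (hf : ∀ i, π (f i) = i) :
    ∃ σ : ℂ →+* B, (∀ z, π (σ z) = z) ∧ ∀ i : s, σ i = f i := by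
  classical
  let g : Algebra.adjoin ℚ (Set.range ((↑) : s → ℂ)) →ₐ[ℚ] B :=
    (MvPolynomial.aeval f : MvPolynomial s ℚ →ₐ[ℚ] B).comp
      (hs.1.aevalEquiv.symm : _ →ₐ[ℚ] _)
  let := g.toRingHom.toAlgebra
  have hcomp : ∀ r : Algebra.adjoin ℚ (Set.range ((↑) : s → ℂ)), π (g r) = r := by
    intro r
    obtain ⟨p, rfl⟩ := hs.1.aevalEquiv.surjective r
    have : π.comp (MvPolynomial.aeval f) = MvPolynomial.aeval ((↑) : s → ℂ) := by
      ext i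
      simp [hf]
    simpa [g] using DFunLike.congr_fun this p
  have : Algebra.FormallySmooth (Algebra.adjoin ℚ (Set.range ((↑) : s → ℂ)))
      (IntermediateField.adjoin ℚ (Set.range ((↑) : s → ℂ))) :=
    .of_isLocalization (nonZeroDivisors _)
  have := hs.isAlgebraic_field
  have : Algebra.FormallyEtale (IntermediateField.adjoin ℚ (Set.range ((↑) : s → ℂ))) ℂ :=
    Algebra.FormallyEtale.of_isSeparable _ ℂ
  have : Algebra.FormallySmooth (Algebra.adjoin ℚ (Set.range ((↑) : s → ℂ))) ℂ :=
    .comp _ (IntermediateField.adjoin ℚ (Set.range ((↑) : s → ℂ))) _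
  let π' : B →ₐ[Algebra.adjoin ℚ (Set.range ((↑) : s → ℂ))] ℂ :=
    { (π : B →+* ℂ) with commutes' := hcomp }
  have hker' : IsNilpotent (RingHom.ker (π' : B →+* ℂ)) := ⟨2, hker⟩
  let σ := Algebra.FormallySmooth.liftOfSurjective (AlgHom.id _ ℂ) π' hπ hker'
  refine ⟨σ.toRingHom, fun z => ?_, fun i => ?_⟩
  · exact Algebra.FormallySmooth.liftOfSurjective_apply (AlgHom.id _ ℂ) π' hπ hker' z
  · have h := σ.commutes (hs.1.aevalEquiv (MvPolynomial.X i))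
    rw [hs.1.algebraMap_aevalEquiv] at h
    simpa [RingHom.algebraMap_toAlgebra, g] using h

lemma AlgebraicIndependent.exists_derivation {ι : Type} {x : ι → ℂ}
    (hx : AlgebraicIndependent ℚ x) (c : ι → ℂ) :
    ∃ D : ℂ →+ ℂ, (∀ a b, D (a * b) = a * D b + D a * b) ∧ ∀ i, D (x i) = c i := by
  classical
  obtain ⟨s, hxs, hs⟩ := exists_isTranscendenceBasis_superset (s := Set.range x)
    ((algebraicIndependent_subtype_range hx.injective).2 hx)
  obtain ⟨σ, hσ, hσs⟩ := exists_squareZero_lift hs (B := DualNumber ℂ)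
    ((TrivSqZeroExt.fstHom ℂ ℂ ℂ).restrictScalars ℚ)
    (fun z => ⟨TrivSqZeroExt.inl z, by simp⟩)
    (by
      rw [eq_bot_iff, pow_two, Ideal.mul_le]
      intro a ha b hb
      have ha' : a.fst = 0 := ha
      have hb' : b.fst = 0 := hb
      ext <;> simp [ha', hb'])
    (fun z => TrivSqZeroExt.inl (z : ℂ) + TrivSqZeroExt.inr (Function.extend x c 0 z))
    (by simp)
  have hσ' : ∀ z, (σ z).fst = z := hσ
  refine ⟨⟨⟨fun z => (σ z).snd, by simp⟩, by simp⟩, fun a b => ?_, fun i => ?_⟩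
  · simp [hσ', mul_comm]
  · have := hσs ⟨x i, hxs ⟨i, rfl⟩⟩
    simp only at this
    simp [this, hx.injective.extend_apply]

lemma exists_ringHom_lift {s : Set ℂ} (hs : IsTranscendenceBasis ℚ ((↑) : s → ℂ))
    {M : Type} [Field M] [IsAlgClosed M] [Algebra ℚ M] (f : s → M) (hf : AlgebraicIndependent ℚ f) :
    ∃ σ : ℂ →+* M, ∀ i : s, σ i = f i := by
  classical
  let g : Algebra.adjoin ℚ (Set.range ((↑) : s → ℂ)) →+* M :=
    ((MvPolynomial.aeval f : MvPolynomial s ℚ →ₐ[ℚ] M).comp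
      (hs.1.aevalEquiv.symm : _ →ₐ[ℚ] _)).toRingHom
  have hg : Function.Injective g :=
    Function.Injective.comp (g := MvPolynomial.aeval f) hf hs.1.aevalEquiv.symm.injective
  let := g.toAlgebra
  have : FaithfulSMul (Algebra.adjoin ℚ (Set.range ((↑) : s → ℂ))) M :=
    (faithfulSMul_iff_algebraMap_injective _ _).2 hg
  have := hs.isAlgebraic
  let σ : ℂ →ₐ[Algebra.adjoin ℚ (Set.range ((↑) : s → ℂ))] M := IsAlgClosed.lift
  refine ⟨σ.toRingHom, fun i => ?_⟩
  have h := σ.commutes (hs.1.aevalEquiv (MvPolynomial.X i))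
  rw [hs.1.algebraMap_aevalEquiv] at h
  simpa [RingHom.algebraMap_toAlgebra, g] using h

lemma mk_transcendenceBasis {s : Set ℂ} (hs : IsTranscendenceBasis ℚ ((↑) : s → ℂ)) :
    Cardinal.mk s = Cardinal.mk ℂ := by
  refine (IsAlgClosed.cardinal_eq_cardinal_transcendence_basis_of_aleph0_lt' _ hs ?_ ?_).symm
  · simp
  · simpa using Cardinal.aleph0_lt_continuum

lemma AlgebraicIndependent.exists_ringHom {ι : Type} [Finite ι] {x y : ι → ℂ}
    (hx : AlgebraicIndependent ℚ x) (hy : AlgebraicIndependent ℚ y) :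
    ∃ σ : ℂ →+* ℂ, ∀ i, σ (x i) = y i := by
  classical
  obtain ⟨s, hxs, hs⟩ := exists_isTranscendenceBasis_superset (s := Set.range x)
    ((algebraicIndependent_subtype_range hx.injective).2 hx)
  obtain ⟨t, hyt, ht⟩ := exists_isTranscendenceBasis_superset (s := Set.range y)
    ((algebraicIndependent_subtype_range hy.injective).2 hy)
  have hst : Cardinal.mk s = Cardinal.mk t := by
    rw [mk_transcendenceBasis hs, mk_transcendenceBasis ht]
  let X : ι → s := fun i => ⟨x i, hxs ⟨i, rfl⟩⟩
  let Y : ι → t := fun i => ⟨y i, hyt ⟨i, rfl⟩⟩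
  have hX : Function.Injective X := fun i j h => hx.injective (congrArg Subtype.val h)
  have hY : Function.Injective Y := fun i j h => hy.injective (congrArg Subtype.val h)
  let f : Set.range X ↪ t := ⟨fun z => Y ((Equiv.ofInjective X hX).symm z),
    hY.comp (Equiv.injective _)⟩
  obtain ⟨e, he⟩ := Cardinal.extend_function_of_lt f (by
    calc _ < Cardinal.aleph0 := (Set.finite_range X).lt_aleph0
      _ ≤ _ := by rw [mk_transcendenceBasis hs]; simpa using Cardinal.aleph0_le_continuum)
    (Cardinal.eq.1 hst)
  obtain ⟨σ, hσ⟩ := exists_ringHom_lift hs (fun i => (e i : ℂ)) (ht.1.comp e e.injective)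
  refine ⟨σ, fun i => ?_⟩
  have := he ⟨X i, i, rfl⟩
  have h2 : (Equiv.ofInjective X hX).symm ⟨X i, i, rfl⟩ = i := by
    rw [Equiv.symm_apply_eq]; rfl
  simp only [f, Function.Embedding.coeFn_mk, h2] at this
  rw [show x i = ((X i : s) : ℂ) from rfl, hσ, this]

lemma exists_algebraicIndependent (ι : Type) [Finite ι] :
    ∃ x : ι → ℂ, AlgebraicIndependent ℚ x := by
  obtain ⟨s, hs⟩ := exists_isTranscendenceBasis ℚ ℂ
  have : Infinite s := by
    rw [Cardinal.infinite_iff, mk_transcendenceBasis hs]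
    simpa using Cardinal.aleph0_le_continuum
  obtain ⟨f⟩ : Nonempty (ι ↪ s) := by
    obtain ⟨n, ⟨e⟩⟩ := Finite.exists_equiv_fin ι
    exact ⟨(e.toEmbedding.trans Fin.valEmbedding).trans (Infinite.natEmbedding s)⟩
  exact ⟨_, hs.1.comp f f.injective⟩

lemma AlgebraicIndependent.countable_line {ι : Type} [Finite ι] {x : ι → ℂ}
    (hx : AlgebraicIndependent ℚ x) (y : ι → ℂ) :
    {t : ℂ | ¬ AlgebraicIndependent ℚ (fun i => x i + t * y i)}.Countable := by
  classical
  obtain ⟨P, hP⟩ : ∃ P : MvPolynomial ι ℚ → Polynomial ℂ,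
      ∀ p t, (P p).eval t = MvPolynomial.aeval (fun i => x i + t * y i) p := by
    refine ⟨fun p => MvPolynomial.aeval
      (fun i => Polynomial.C (x i) + Polynomial.X * Polynomial.C (y i)) p, fun p t => ?_⟩
    have : (((Polynomial.aeval t : Polynomial ℂ →ₐ[ℂ] ℂ).restrictScalars ℚ).comp
      (MvPolynomial.aeval (fun i => Polynomial.C (x i) + Polynomial.X * Polynomial.C (y i)))) p =
      MvPolynomial.aeval (fun i => x i + t * y i) p := by
      congr 1
      ext i
      simp; ring
    simpa [Polynomial.coe_aeval_eq_eval] using this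
  have : {t : ℂ | ¬ AlgebraicIndependent ℚ (fun i => x i + t * y i)} ⊆
      ⋃ p : {p : MvPolynomial ι ℚ // p ≠ 0}, {t | (P p.1).eval t = 0} := by
    intro t ht
    rw [Set.mem_ofPred_eq, algebraicIndependent_iff] at ht
    push Not at ht
    obtain ⟨p, h0, hp⟩ := ht
    exact Set.mem_iUnion.2 ⟨⟨p, hp⟩, by rw [Set.mem_ofPred_eq, hP]; exact h0⟩
  refine Set.Countable.mono this ?_
  have : Countable (MvPolynomial ι ℚ) := by
    rw [← Cardinal.mk_le_aleph0_iff]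
    exact MvPolynomial.cardinalMk_le_max.trans (by simp [Cardinal.mk_le_aleph0])
  refine Set.countable_iUnion fun p => ?_
  have hp0 : P p.1 ≠ 0 := by
    intro h
    have := hP p.1 0
    rw [h] at this
    simp only [Polynomial.eval_zero, zero_mul, add_zero] at this
    exact p.2 (algebraicIndependent_iff.1 hx _ this.symm)
  refine ((P p.1).roots.toFinset.finite_toSet.subset ?_).countable
  intro t ht
  simpa [hp0] using ht

end Field

section Rep

variable {V A : Type} {src tgt : A → V}

/-- Representations of a quiver by complex matrices, with coordinates at the vertex `x` indexed
by `N x`. -/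
abbrev MatRep (src tgt : A → V) (N : V → Type) : Type :=
  ∀ a : A, Matrix (N (tgt a)) (N (src a)) ℂ

/-- The family of all matrix entries of a representation. -/
def MatRep.entries {N : V → Type} (r : MatRep src tgt N) :
    (Σ a : A, N (tgt a) × N (src a)) → ℂ :=
  fun i => r i.1 i.2.1 i.2.2

/-- The representation `r` has a subrepresentation with basis indexed by `M x` at the vertex `x`:
it is spanned by the columns of the matrices `B x`. -/
def MatRep.HasSub {N : V → Type} [∀ x, Fintype (N x)] (r : MatRep src tgt N)
    (M : V → Type) [∀ x, Fintype (M x)] [∀ x, DecidableEq (M x)] : Prop :=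
  ∃ (B : ∀ x, Matrix (N x) (M x) ℂ) (L : ∀ x, Matrix (M x) (N x) ℂ) (s : MatRep src tgt M),
    (∀ x, L x * B x = 1) ∧ ∀ a, r a * B (src a) = B (tgt a) * s a

namespace MatRep

variable {N M : V → Type} [∀ x, Fintype (N x)] [∀ x, Fintype (M x)] [∀ x, DecidableEq (M x)]

lemma HasSub.map {r : MatRep src tgt N} (h : r.HasSub M) (σ : ℂ →+* ℂ) :
    HasSub (fun a => (r a).map σ : MatRep src tgt N) M := by
  obtain ⟨B, L, s, h1, h2⟩ := h
  refine ⟨fun x => (B x).map σ, fun x => (L x).map σ, fun a => (s a).map σ, fun x => ?_,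
    fun a => ?_⟩
  · rw [← Matrix.map_mul, h1]
    simp
  · simp only [← Matrix.map_mul, h2]

lemma HasSub.trans {K : V → Type} [∀ x, Fintype (K x)] [∀ x, DecidableEq (K x)]
    {r : MatRep src tgt N} (h : r.HasSub M) (hM : ∀ s : MatRep src tgt M, s.HasSub K) :
    r.HasSub K := by
  obtain ⟨B, L, s, h1, h2⟩ := h
  obtain ⟨B', L', s', h1', h2'⟩ := hM s
  refine ⟨fun x => B x * B' x, fun x => L' x * L x, s', fun x => ?_, fun a => ?_⟩
  · rw [Matrix.mul_assoc, ← Matrix.mul_assoc (L x), h1, Matrix.one_mul, h1']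
  · rw [← Matrix.mul_assoc, h2, Matrix.mul_assoc, h2', Matrix.mul_assoc]

lemma HasSub.reindex {N' : V → Type} [∀ x, Fintype (N' x)] (e : ∀ x, N x ≃ N' x)
    {r : MatRep src tgt N'}
    (h : HasSub (fun a => (r a).submatrix (e (tgt a)) (e (src a)) : MatRep src tgt N) M) :
    r.HasSub M := by
  obtain ⟨B, L, s, h1, h2⟩ := h
  refine ⟨fun x => (B x).submatrix (e x).symm id, fun x => (L x).submatrix id (e x).symm, s,
    fun x => ?_, fun a => ?_⟩
  · rw [Matrix.submatrix_mul_equiv, h1, Matrix.submatrix_id_id]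
  · ext i j
    have := congrFun (congrFun (h2 a) ((e (tgt a)).symm i)) j
    simp only [Matrix.mul_apply, Matrix.submatrix_apply, Equiv.apply_symm_apply, id] at this ⊢
    rw [← this, ← (e (src a)).sum_comp]
    simp

/-- Matrices describing an invariant family of subspaces. -/
lemma exists_matrices {r : MatRep src tgt N} [∀ x, DecidableEq (N x)]
    {S : ∀ x, Submodule ℂ (N x → ℂ)}
    (hS : ∀ x, Module.finrank ℂ (S x) = Fintype.card (M x))
    (hr : ∀ a, ∀ z ∈ S (src a), r a *ᵥ z ∈ S (tgt a)) :
    ∃ (B : ∀ x, Matrix (N x) (M x) ℂ) (L : ∀ x, Matrix (M x) (N x) ℂ) (s : MatRep src tgt M),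
      (∀ x, L x * B x = 1) ∧ (∀ a, r a * B (src a) = B (tgt a) * s a) ∧
      (∀ x y, B x *ᵥ y ∈ S x) ∧ ∀ x, ∀ z ∈ S x, B x *ᵥ (L x *ᵥ z) = z := by
  have key : ∀ x, ∃ (B : Matrix (N x) (M x) ℂ) (L : Matrix (M x) (N x) ℂ), L * B = 1 ∧
      (∀ y, B *ᵥ y ∈ S x) ∧ ∀ z ∈ S x, B *ᵥ (L *ᵥ z) = z := by
    intro x
    have e : S x ≃ₗ[ℂ] (M x → ℂ) := LinearEquiv.ofFinrankEq _ _ (by simp [hS])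
    obtain ⟨l, hl⟩ := (e : S x →ₗ[ℂ] (M x → ℂ)).exists_extend
    refine ⟨LinearMap.toMatrix' ((S x).subtype ∘ₗ (e.symm : (M x → ℂ) →ₗ[ℂ] S x)),
      LinearMap.toMatrix' l, ?_, fun y => ?_, fun z hz => ?_⟩
    · rw [← LinearMap.toMatrix'_comp, ← LinearMap.comp_assoc, hl]
      simp
    · simp [LinearMap.toMatrix'_mulVec]
    · have := DFunLike.congr_fun hl ⟨z, hz⟩
      simp only [LinearMap.comp_apply, Submodule.subtype_apply] at this
      simp [LinearMap.toMatrix'_mulVec, this]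
  choose B L h1 h2 h3 using key
  refine ⟨B, L, fun a => L (tgt a) * (r a * B (src a)), h1, fun a => ?_, h2, h3⟩
  apply Matrix.ext_of_mulVec_single
  intro i
  simp only [← Matrix.mulVec_mulVec]
  rw [h3 _ _ (hr _ _ (h2 _ _))]

lemma hasSub_of_submodule {r : MatRep src tgt N} {S : ∀ x, Submodule ℂ (N x → ℂ)}
    (hS : ∀ x, Module.finrank ℂ (S x) = Fintype.card (M x))
    (hr : ∀ a, ∀ z ∈ S (src a), r a *ᵥ z ∈ S (tgt a)) : r.HasSub M := by
  classical
  obtain ⟨B, L, s, h1, h2, -⟩ := exists_matrices hS hr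
  exact ⟨B, L, s, h1, h2⟩

lemma HasSub.exists_submodule {r : MatRep src tgt N} (h : r.HasSub M) :
    ∃ S : ∀ x, Submodule ℂ (N x → ℂ), (∀ x, Module.finrank ℂ (S x) = Fintype.card (M x)) ∧
      ∀ a, ∀ z ∈ S (src a), r a *ᵥ z ∈ S (tgt a) := by
  obtain ⟨B, L, s, h1, h2⟩ := h
  refine ⟨fun x => LinearMap.range (B x).mulVecLin, fun x => ?_, ?_⟩
  · rw [LinearMap.finrank_range_of_inj]
    · simp
    · intro y z hyz
      have := congrArg (fun u => L x *ᵥ u) hyz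
      simpa [Matrix.mulVec_mulVec, h1] using this
  · rintro a _ ⟨y, rfl⟩
    refine ⟨s a *ᵥ y, ?_⟩
    simp [Matrix.mulVec_mulVec, h2]

end MatRep

lemma hasSubrepOfDim_iff {n β : V → ℕ} :
    HasSubrepOfDim src tgt n β ↔
      ∀ r : MatRep src tgt (fun x => Fin (n x)), r.HasSub (fun x => Fin (β x)) := by
  constructor
  · intro h r
    obtain ⟨S, h1, h2⟩ := h (fun a => (r a).mulVecLin)
    refine MatRep.hasSub_of_submodule (S := S) (by simpa using h1) fun a z hz => ?_
    exact h2 a (Submodule.mem_map_of_mem hz)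
  · intro h r
    obtain ⟨S, h1, h2⟩ := (h (fun a => LinearMap.toMatrix' (r a))).exists_submodule
    refine ⟨S, by simpa using h1, fun a => ?_⟩
    rintro _ ⟨z, hz, rfl⟩
    simpa [LinearMap.toMatrix'_mulVec] using h2 a z hz

end Rep

section Closed

variable {V A : Type} {src tgt : A → V}

lemma exists_orthonormal_matrix {N M : Type} [Fintype N] [Fintype M] [DecidableEq M]
    (S : Submodule ℂ (N → ℂ)) (hS : Module.finrank ℂ S = Fintype.card M) :
    ∃ B : Matrix N M ℂ, Bᴴ * B = 1 ∧ (∀ y, B *ᵥ y ∈ S) ∧ ∀ z ∈ S, B *ᵥ (Bᴴ *ᵥ z) = z := by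
  let T : Submodule ℂ (EuclideanSpace ℂ N) :=
    S.comap (WithLp.linearEquiv 2 ℂ (N → ℂ) : EuclideanSpace ℂ N →ₗ[ℂ] N → ℂ)
  have hT : Module.finrank ℂ T = Fintype.card M := by
    rw [← hS]
    exact ((WithLp.linearEquiv 2 ℂ (N → ℂ)).ofSubmodule' S).finrank_eq
  let b : OrthonormalBasis M ℂ T := (stdOrthonormalBasis ℂ T).reindex
    (Fintype.equivOfCardEq (by simp [hT]))
  let B : Matrix N M ℂ := Matrix.of fun i j => (b j : EuclideanSpace ℂ N) i
  have h1 : Bᴴ * B = 1 := by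
    ext i j
    have := orthonormal_iff_ite.1 b.orthonormal i j
    simp only [Submodule.coe_inner, PiLp.inner_apply, RCLike.inner_apply] at this
    simp only [Matrix.mul_apply, Matrix.conjTranspose_apply, Matrix.one_apply, B, Matrix.of_apply]
    rw [← this]
    exact Finset.sum_congr rfl fun _ _ => mul_comm _ _
  have h2 : ∀ y, B *ᵥ y = WithLp.ofLp ((∑ j, y j • b j : T) : EuclideanSpace ℂ N) := by
    intro y
    ext i
    simp [B, Matrix.mulVec, dotProduct, mul_comm]
  refine ⟨B, h1, fun y => ?_, fun z hz => ?_⟩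
  · rw [h2]
    exact (∑ j, y j • b j : T).2
  · obtain ⟨y, rfl⟩ : ∃ y, B *ᵥ y = z := by
      let z' : T := ⟨WithLp.toLp 2 z, hz⟩
      refine ⟨fun j => b.repr z' j, ?_⟩
      rw [h2, b.sum_repr]
    rw [Matrix.mulVec_mulVec _ Bᴴ, h1, Matrix.one_mulVec]

variable {N M : V → Type} [∀ x, Fintype (N x)] [∀ x, Fintype (M x)] [∀ x, DecidableEq (M x)]

lemma MatRep.hasSub_iff_orthonormal {r : MatRep src tgt N} :
    r.HasSub M ↔ ∃ B : ∀ x, Matrix (N x) (M x) ℂ, (∀ x, (B x)ᴴ * B x = 1) ∧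
      ∀ a, r a * B (src a) = B (tgt a) * ((B (tgt a))ᴴ * (r a * B (src a))) := by
  constructor
  · intro h
    obtain ⟨S, hS, hr⟩ := h.exists_submodule
    choose B h1 h2 h3 using fun x => exists_orthonormal_matrix (S x) (hS x)
    refine ⟨B, h1, fun a => ?_⟩
    apply Matrix.ext_of_mulVec_single
    intro i
    simp only [← Matrix.mulVec_mulVec]
    rw [h3 _ _ (hr _ _ (h2 _ _))]
  · rintro ⟨B, h1, h2⟩
    exact ⟨B, fun x => (B x)ᴴ, _, h1, h2⟩

lemma isCompact_orthonormal_matrix (N M : Type) [Fintype N] [Fintype M] [DecidableEq M] :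
    IsCompact {B : Matrix N M ℂ | Bᴴ * B = 1} := by
  have hc : IsCompact (Set.univ.pi fun _ : N => Set.univ.pi fun _ : M =>
      Metric.closedBall (0 : ℂ) 1) :=
    isCompact_univ_pi fun _ => isCompact_univ_pi fun _ => isCompact_closedBall _ _
  refine hc.of_isClosed_subset (isClosed_eq (by fun_prop) continuous_const) ?_
  intro (B : Matrix N M ℂ) hB i _ j _
  have h := congrFun (congrFun (show Bᴴ * B = 1 from hB) j) j
  have h' : ∑ k, ‖B k j‖ ^ 2 = 1 := by
    simp only [Matrix.mul_apply, Matrix.conjTranspose_apply, Matrix.one_apply_eq,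
      RCLike.star_def, Complex.conj_mul'] at h
    exact_mod_cast h
  have h2 : ‖B i j‖ ^ 2 ≤ 1 := by
    rw [← h']
    exact Finset.single_le_sum (f := fun k => ‖B k j‖ ^ 2) (fun _ _ => by positivity)
      (Finset.mem_univ i)
  simpa using (sq_le_one_iff₀ (norm_nonneg _)).1 h2

lemma MatRep.isClosed_hasSub : IsClosed {r : MatRep src tgt N | r.HasSub M} := by
  let K : Set (∀ x, Matrix (N x) (M x) ℂ) := Set.univ.pi fun x => {B | Bᴴ * B = 1}
  have hK : IsCompact K := isCompact_univ_pi fun x => isCompact_orthonormal_matrix _ _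
  have : CompactSpace K := isCompact_iff_compactSpace.1 hK
  let Z : Set (K × MatRep src tgt N) := {p | ∀ a, p.2 a * p.1.1 (src a) =
    p.1.1 (tgt a) * ((p.1.1 (tgt a))ᴴ * (p.2 a * p.1.1 (src a)))}
  have hZ : IsClosed Z := by
    simp only [Z, Set.ofPred_forall]
    refine isClosed_iInter fun a => ?_
    have h1 : Continuous fun p : K × MatRep src tgt N => p.2 a := by fun_prop
    have h2 : ∀ x, Continuous fun p : K × MatRep src tgt N => p.1.1 x := fun x =>
      (continuous_apply x).comp (continuous_subtype_val.comp continuous_fst)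
    have h3 := h1.matrix_mul (h2 (src a))
    exact isClosed_eq h3 ((h2 _).matrix_mul ((h2 _).matrix_conjTranspose.matrix_mul h3))
  convert isClosedMap_snd_of_compactSpace _ hZ
  ext r
  simp only [Set.mem_image, Prod.exists, exists_eq_right]
  refine MatRep.hasSub_iff_orthonormal.trans ?_
  constructor
  · rintro ⟨B, h1, h2⟩
    exact ⟨⟨B, fun x _ => h1 x⟩, h2⟩
  · rintro ⟨B, h⟩
    exact ⟨B.1, fun x => B.2 x trivial, h⟩

lemma MatRep.HasSub.of_generic [Finite A] {r : MatRep src tgt N} (h : r.HasSub M)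
    (hr : AlgebraicIndependent ℚ r.entries) (r' : MatRep src tgt N) : r'.HasSub M := by
  let f : ℂ → MatRep src tgt N := fun t a => r a + t • (r' a - r a)
  have hf : IsClosed (f ⁻¹' {r | r.HasSub M}) :=
    MatRep.isClosed_hasSub.preimage (by fun_prop)
  have hc := hr.countable_line (MatRep.entries fun a => r' a - r a)
  have hd := hc.dense_compl ℂ
  have : f ⁻¹' {r | r.HasSub M} = Set.univ := by
    rw [← hf.closure_eq]
    refine (hd.mono ?_).closure_eq
    intro t ht
    have ht' : AlgebraicIndependent ℚ (f t).entries := not_not.1 ht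
    obtain ⟨σ, hσ⟩ := hr.exists_ringHom ht'
    have : f t = fun a => (r a).map σ := by
      ext a i j
      exact (hσ ⟨a, i, j⟩).symm
    simp only [Set.mem_preimage, Set.mem_ofPred_eq, this]
    exact h.map σ
  have h1 : (1 : ℂ) ∈ f ⁻¹' {r | r.HasSub M} := this ▸ trivial
  simpa [f] using h1

end Closed

section Tangent

lemma Matrix.map_mul_of_leibniz {l m n : Type} [Fintype m] {D : ℂ →+ ℂ}
    (hD : ∀ a b, D (a * b) = a * D b + D a * b) (X : Matrix l m ℂ) (Y : Matrix m n ℂ) :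
    (X * Y).map D = X * Y.map D + X.map D * Y := by
  ext i j
  simp [Matrix.mul_apply, hD, Finset.sum_add_distrib]

variable {V A : Type} {src tgt : A → V}
variable {N M G : V → Type} [∀ x, Fintype (N x)] [∀ x, Fintype (M x)] [∀ x, Fintype (G x)]

/-- The coboundary map of a pair of representations: its kernel consists of the morphisms from
`v` to `w`, and its cokernel is the space of extensions. -/
def MatRep.coboundary (v : MatRep src tgt N) (w : MatRep src tgt G) :
    (∀ x, Matrix (G x) (N x) ℂ) →ₗ[ℂ] ∀ a, Matrix (G (tgt a)) (N (src a)) ℂ where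
  toFun φ a := w a * φ (src a) - φ (tgt a) * v a
  map_add' φ ψ := by
    ext1 a
    simp only [Pi.add_apply, Matrix.mul_add, Matrix.add_mul]
    abel
  map_smul' c φ := by
    ext1 a
    simp [smul_sub]

@[simp]
lemma MatRep.coboundary_apply (v : MatRep src tgt N) (w : MatRep src tgt G)
    (φ : ∀ x, Matrix (G x) (N x) ℂ) (a : A) :
    MatRep.coboundary v w φ a = w a * φ (src a) - φ (tgt a) * v a := rfl

/-- A pair of representations is generic if all their entries are algebraically independent. -/
def MatRep.GenericPair (v : MatRep src tgt N) (w : MatRep src tgt G) : Prop :=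
  AlgebraicIndependent ℚ (Sum.elim v.entries w.entries)

/-- For a generic pair, morphisms extend along first order deformations of the target. -/
lemma MatRep.GenericPair.mul_mem_range {v : MatRep src tgt N} {w : MatRep src tgt G}
    (h : v.GenericPair w) {φ : ∀ x, Matrix (G x) (N x) ℂ} (hφ : MatRep.coboundary v w φ = 0)
    (w' : MatRep src tgt G) :
    (fun a => w' a * φ (src a)) ∈ LinearMap.range (MatRep.coboundary v w) := by
  obtain ⟨D, hD, hc⟩ := h.exists_derivation (Sum.elim 0 (MatRep.entries w'))
  have hv : ∀ a, (v a).map D = 0 := fun a => by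
    ext i j
    exact hc (Sum.inl ⟨a, i, j⟩)
  have hw : ∀ a, (w a).map D = w' a := fun a => by
    ext i j
    exact hc (Sum.inr ⟨a, i, j⟩)
  refine ⟨fun x => -(φ x).map D, ?_⟩
  ext1 a
  have h1 : w a * φ (src a) = φ (tgt a) * v a := sub_eq_zero.1 (congrFun hφ a)
  have h2 := congrArg (fun X => X.map D) h1
  simp only [Matrix.map_mul_of_leibniz hD, hv, hw, Matrix.mul_zero, zero_add] at h2
  simp [← h2]

lemma MatRep.HasSub.edim_nonneg [Fintype V] [Fintype A] [∀ x, DecidableEq (M x)]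
    {r : MatRep src tgt N} (h : r.HasSub M) (hr : AlgebraicIndependent ℚ r.entries) :
    0 ≤ (∑ x, (Fintype.card (M x) : ℤ) * (Fintype.card (N x) - Fintype.card (M x))) -
      ∑ a, (Fintype.card (M (src a)) : ℤ) *
        (Fintype.card (N (tgt a)) - Fintype.card (M (tgt a))) := by
  obtain ⟨B, L, s, hLB, hrB⟩ := h
  let Ψ : ((∀ x, Matrix (N x) (M x) ℂ) × MatRep src tgt M) →ₗ[ℂ]
      ∀ a, Matrix (N (tgt a)) (M (src a)) ℂ :=
    { toFun p a := B (tgt a) * p.2 a + p.1 (tgt a) * s a - r a * p.1 (src a)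
      map_add' p q := by
        ext1 a
        simp only [Prod.fst_add, Prod.snd_add, Pi.add_apply, Matrix.mul_add, Matrix.add_mul]
        abel
      map_smul' c p := by
        ext1 a
        simp [smul_sub] }
  let κ : (∀ x, Matrix (M x) (M x) ℂ) →ₗ[ℂ]
      ((∀ x, Matrix (N x) (M x) ℂ) × MatRep src tgt M) :=
    { toFun g := (fun x => B x * g x, fun a => s a * g (src a) - g (tgt a) * s a)
      map_add' g g' := by
        ext1
        · ext1 x
          simp [Matrix.mul_add]
        · ext1 x
          simp only [Prod.snd_add, Pi.add_apply, Matrix.mul_add, Matrix.add_mul]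
          abel
      map_smul' c g := by
        ext1
        · ext1 x
          simp
        · ext1 x
          simp [smul_sub] }
  have hΨ : LinearMap.range Ψ = ⊤ := by
    rw [LinearMap.range_eq_top]
    intro c
    obtain ⟨D, hD, hc⟩ := hr.exists_derivation (MatRep.entries fun a => c a * L (src a))
    have hr' : ∀ a, (r a).map D = c a * L (src a) := fun a => by
      ext i j
      exact hc ⟨a, i, j⟩
    refine ⟨(fun x => (B x).map D, fun a => (s a).map D), ?_⟩
    ext1 a
    have h2 := congrArg (fun X => X.map D) (hrB a)
    simp only [Matrix.map_mul_of_leibniz hD, hr', Matrix.mul_assoc, hLB, Matrix.mul_one] at h2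
    exact sub_eq_of_eq_add (h2.symm.trans (add_comm _ _))
  have hκ : Function.Injective κ := by
    intro g g' hg
    ext1 x
    have := congrArg (fun X => L x * X) (congrFun (congrArg Prod.fst hg) x)
    simpa [κ, ← Matrix.mul_assoc, hLB] using this
  have hκΨ : LinearMap.range κ ≤ LinearMap.ker Ψ := by
    rintro _ ⟨g, rfl⟩
    rw [LinearMap.mem_ker]
    ext1 a
    simp only [Ψ, κ, LinearMap.coe_mk, AddHom.coe_mk, ← Matrix.mul_assoc, hrB, Matrix.mul_sub,
      Pi.zero_apply]
    abel
  have h1 := LinearMap.finrank_range_add_finrank_ker Ψ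
  have h2 := (LinearMap.finrank_range_of_inj hκ).symm.trans_le (Submodule.finrank_mono hκΨ)
  rw [hΨ, finrank_top] at h1
  simp only [Module.finrank_pi_fintype, Module.finrank_matrix, Module.finrank_prod,
    Module.finrank_self, mul_one] at h1 h2
  zify at h1 h2
  simp only [mul_sub, Finset.sum_sub_distrib]
  have e1 : ∑ x, (Fintype.card (M x) : ℤ) * Fintype.card (N x) =
    ∑ x, (Fintype.card (N x) : ℤ) * Fintype.card (M x) :=
    Finset.sum_congr rfl fun _ _ => mul_comm _ _
  have e2 : ∑ a, (Fintype.card (M (src a)) : ℤ) * Fintype.card (N (tgt a)) =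
    ∑ a, (Fintype.card (N (tgt a)) : ℤ) * Fintype.card (M (src a)) :=
    Finset.sum_congr rfl fun _ _ => mul_comm _ _
  have e3 : ∑ a, (Fintype.card (M (src a)) : ℤ) * Fintype.card (M (tgt a)) =
    ∑ a, (Fintype.card (M (tgt a)) : ℤ) * Fintype.card (M (src a)) :=
    Finset.sum_congr rfl fun _ _ => mul_comm _ _
  linarith

lemma HasSubrepOfDim.edim_nonneg [Fintype V] [Fintype A] {n β : V → ℕ}
    (h : HasSubrepOfDim src tgt n β) :
    0 ≤ (∑ x, (β x : ℤ) * ((n x : ℤ) - β x)) -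
      ∑ a, (β (src a) : ℤ) * ((n (tgt a) : ℤ) - β (tgt a)) := by
  obtain ⟨x, hx⟩ := exists_algebraicIndependent (Σ a : A, Fin (n (tgt a)) × Fin (n (src a)))
  have := (hasSubrepOfDim_iff.1 h fun a i j => x ⟨a, i, j⟩).edim_nonneg hx
  simpa using this

end Tangent

section Deformation

open Topology in
/-- A linear equation with a surjective left hand side stays solvable after a small `C¹`
perturbation. -/
lemma LinearMap.eventually_exists_add_smul_eq_zero {X Y : Type*} [NormedAddCommGroup X]
    [NormedSpace ℂ X] [FiniteDimensional ℂ X] [NormedAddCommGroup Y] [NormedSpace ℂ Y]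
    [FiniteDimensional ℂ Y] {d : X →ₗ[ℂ] Y} (hd : Function.Surjective d) {q : X → Y}
    (hq : ContDiff ℂ 1 q) : ∀ᶠ t in 𝓝 (0 : ℂ), ∃ h, d h + t • q h = 0 := by
  have := FiniteDimensional.complete ℂ X
  have := FiniteDimensional.complete ℂ Y
  let d' : X →L[ℂ] Y := d.toContinuousLinearMap
  let F : ℂ × X → ℂ × Y := fun p => (p.1, d' p.2 + p.1 • q p.2)
  have hF : HasStrictFDerivAt F ((ContinuousLinearMap.fst ℂ ℂ X).prod
      (d' ∘L ContinuousLinearMap.snd ℂ ℂ X +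
        (ContinuousLinearMap.fst ℂ ℂ X).smulRight (q 0))) (0, 0) := by
    have h1 : HasStrictFDerivAt (fun p : ℂ × X => q p.2)
        (fderiv ℂ q 0 ∘L ContinuousLinearMap.snd ℂ ℂ X) (0, 0) :=
      HasStrictFDerivAt.comp (0, 0) (hq.contDiffAt.hasStrictFDerivAt one_ne_zero)
        hasStrictFDerivAt_snd
    have h2 := (hasStrictFDerivAt_fst (𝕜 := ℂ) (p := ((0 : ℂ), (0 : X)))).smul h1
    have h3 := (d' ∘L ContinuousLinearMap.snd ℂ ℂ X).hasStrictFDerivAt (x := ((0 : ℂ), (0 : X)))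
    refine (hasStrictFDerivAt_fst.prodMk (h3.add h2)).congr_fderiv ?_
    ext <;> simp
  have hmap := hF.map_nhds_eq_of_surj <| LinearMap.range_eq_top.2 fun p => by
    obtain ⟨x, hx⟩ := hd (p.2 - p.1 • q 0)
    exact ⟨(p.1, x), by simp [d', hx]⟩
  have hr : Set.range F ∈ 𝓝 (F (0, 0)) := by
    rw [← hmap]
    exact Filter.range_mem_map
  have h0 : F (0, 0) = (0, 0) := by simp [F]
  rw [h0] at hr
  have hc : Continuous fun t : ℂ => (t, (0 : Y)) := by fun_prop
  filter_upwards [hc.continuousAt.preimage_mem_nhds (x := 0) hr]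
  rintro t ⟨⟨t', x⟩, h⟩
  obtain ⟨rfl, h⟩ := Prod.ext_iff.1 h
  exact ⟨x, h⟩

variable {V A : Type} {src tgt : A → V}
variable {N G : V → Type} [∀ x, Fintype (N x)] [∀ x, Fintype (G x)] [∀ x, DecidableEq (N x)]

lemma MatRep.hasSub_fromBlocks (v P : ∀ a, Matrix (N (tgt a)) (N (src a)) ℂ)
    (w S : ∀ a, Matrix (G (tgt a)) (G (src a)) ℂ) (Q : ∀ a, Matrix (N (tgt a)) (G (src a)) ℂ)
    (R : ∀ a, Matrix (G (tgt a)) (N (src a)) ℂ) (t : ℂ) (h : ∀ x, Matrix (G x) (N x) ℂ)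
    (hh : ∀ a, w a * h (src a) - h (tgt a) * v a + t • (R a + S a * h (src a) - h (tgt a) * P a -
      h (tgt a) * Q a * h (src a)) = 0) :
    MatRep.HasSub (src := src) (tgt := tgt) (N := fun x => N x ⊕ G x) (fun a =>
      fromBlocks (v a) 0 0 (w a) + t • fromBlocks (P a) (Q a) (R a) (S a)) N := by
  refine ⟨fun x => fromRows 1 (h x), fun x => fromCols 1 0,
    fun a => v a + t • P a + t • Q a * h (src a), fun x => ?_, fun a => ?_⟩
  · simp [fromCols_mul_fromRows]
  · have h1 := hh a
    dsimp only
    rw [fromBlocks_smul, fromBlocks_add, ← fromRows_fromCols_eq_fromBlocks, fromRows_mul,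
      fromRows_mul]
    simp only [fromCols_mul_fromRows, Matrix.one_mul, Matrix.mul_one, zero_add, Matrix.mul_add,
      Matrix.add_mul, Matrix.smul_mul, Matrix.mul_smul, smul_sub, smul_add,
      ← Matrix.mul_assoc] at h1 ⊢
    congr 1
    rw [← sub_eq_zero, ← h1]
    abel

lemma MatRep.hasSub_of_surjective [Finite V] [Finite A] {v : MatRep src tgt N}
    {w : MatRep src tgt G} (hd : Function.Surjective (MatRep.coboundary v w))
    (r : MatRep src tgt fun x => N x ⊕ G x) : r.HasSub N := by
  have := Fintype.ofFinite V
  have := Fintype.ofFinite A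
  obtain ⟨z, hz⟩ := exists_algebraicIndependent
    (Σ a : A, (N (tgt a) ⊕ G (tgt a)) × (N (src a) ⊕ G (src a)))
  let r₀ : MatRep src tgt fun x => N x ⊕ G x := fun a => fromBlocks (v a) 0 0 (w a)
  let r₁ : MatRep src tgt fun x => N x ⊕ G x := fun a i j => z ⟨a, i, j⟩
  let Δ := r₁ - r₀
  let P := fun a => (Δ a).toBlocks₁₁
  let Q := fun a => (Δ a).toBlocks₁₂
  let R := fun a => (Δ a).toBlocks₂₁
  let S := fun a => (Δ a).toBlocks₂₂
  let q : (∀ x, G x → N x → ℂ) → ∀ a, G (tgt a) → N (src a) → ℂ := fun h a =>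
    R a + S a * Matrix.of (h (src a)) - Matrix.of (h (tgt a)) * P a -
      Matrix.of (h (tgt a)) * Q a * Matrix.of (h (src a))
  have hq : ContDiff ℂ 1 q := by
    refine contDiff_pi.2 fun a => contDiff_pi.2 fun i => contDiff_pi.2 fun j => ?_
    simp only [q, Matrix.mul_apply, Matrix.sub_apply, Matrix.add_apply, Matrix.of_apply]
    have hc : ∀ y i j, ContDiff ℂ 1 fun h : (∀ x, G x → N x → ℂ) => h y i j := fun y i j =>
      contDiff_pi.1 (contDiff_pi.1 (contDiff_pi.1 contDiff_id y) i) j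
    exact ((contDiff_const.add (ContDiff.sum fun k _ => contDiff_const.mul (hc _ _ _))).sub
      (ContDiff.sum fun k _ => (hc _ _ _).mul contDiff_const)).sub (ContDiff.sum fun k _ =>
        (ContDiff.sum fun l _ => (hc _ _ _).mul contDiff_const).mul (hc _ _ _))
  have h1 := LinearMap.eventually_exists_add_smul_eq_zero (X := ∀ x, G x → N x → ℂ)
    (Y := ∀ a, G (tgt a) → N (src a) → ℂ) (d := MatRep.coboundary v w) hd hq
  have hz' : AlgebraicIndependent ℚ r₁.entries := hz
  have h2 := ((hz'.countable_line (MatRep.entries (r₀ - r₁))).preimage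
    (sub_right_injective (b := (1 : ℂ)))).dense_compl ℂ
  obtain ⟨t, ht, h, hh⟩ := h2.inter_nhds_nonempty h1
  have hgen : AlgebraicIndependent ℚ (MatRep.entries (src := src) (tgt := tgt)
      (N := fun x => N x ⊕ G x) fun a => r₀ a + t • Δ a) := by
    convert not_not.1 ht using 1
    ext i
    simp [MatRep.entries, Δ]
    ring
  refine MatRep.HasSub.of_generic ?_ hgen r
  have hΔ : ∀ a, Δ a = fromBlocks (P a) (Q a) (R a) (S a) := fun a =>
    (fromBlocks_toBlocks (Δ a)).symm
  simp only [hΔ]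
  exact MatRep.hasSub_fromBlocks v P w S Q R t h fun a => congrFun hh a

end Deformation

section Generic

lemma LinearMap.exists_comp_eq_of_ker_le {K X Y Z : Type*} [Field K] [AddCommGroup X] [Module K X]
    [AddCommGroup Y] [Module K Y] [AddCommGroup Z] [Module K Z] {f : X →ₗ[K] Y} {g : X →ₗ[K] Z}
    (h : LinearMap.ker f ≤ LinearMap.ker g) : ∃ k : Y →ₗ[K] Z, k ∘ₗ f = g := by
  obtain ⟨k, hk⟩ := ((LinearMap.ker f).liftQ g h ∘ₗ
    (f.quotKerEquivRange.symm : LinearMap.range f →ₗ[K] X ⧸ LinearMap.ker f)).exists_extend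
  refine ⟨k, ?_⟩
  ext x
  have := DFunLike.congr_fun hk (f.quotKerEquivRange (Submodule.Quotient.mk x))
  simpa using this

lemma Matrix.exists_mul_eq_of_ker {l m n : Type} [Fintype l] [Fintype m] [Fintype n]
    {P : Matrix m n ℂ} {C : Matrix l n ℂ} (h : ∀ z, P *ᵥ z = 0 → C *ᵥ z = 0) :
    ∃ W : Matrix l m ℂ, W * P = C := by
  classical
  obtain ⟨k, hk⟩ := LinearMap.exists_comp_eq_of_ker_le (f := P.mulVecLin) (g := C.mulVecLin)
    fun z hz => h z hz
  refine ⟨LinearMap.toMatrix' k, ?_⟩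
  apply Matrix.ext_of_mulVec_single
  intro i
  have := DFunLike.congr_fun hk (Pi.single i 1)
  rw [← Matrix.mulVec_mulVec, LinearMap.toMatrix'_mulVec]
  exact this

lemma LinearMap.finite_not_surjective_add_smul {K X Y : Type*} [Field K] [AddCommGroup X]
    [Module K X] [AddCommGroup Y] [Module K Y] [FiniteDimensional K Y] {f g : X →ₗ[K] Y}
    (h : Function.Surjective (f + g)) : {t : K | ¬ Function.Surjective (f + t • g)}.Finite := by
  obtain ⟨R, hR⟩ := (f + g).exists_rightInverse_of_surjective (LinearMap.range_eq_top.2 h)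
  refine ((Module.End.finite_hasEigenvalue (g ∘ₗ R)).image fun μ => 1 - μ⁻¹).subset fun t ht => ?_
  have h1 : (f + t • g) ∘ₗ R = 1 + (t - 1) • (g ∘ₗ R) := by
    have : f ∘ₗ R = 1 - g ∘ₗ R := by
      rw [eq_sub_iff_add_eq, ← LinearMap.add_comp, hR]
      rfl
    rw [LinearMap.add_comp, LinearMap.smul_comp, this, sub_smul, one_smul]
    abel
  have h2 : ¬ Function.Injective ((f + t • g) ∘ₗ R) := fun hi =>
    ht (Function.Surjective.of_comp (LinearMap.injective_iff_surjective.1 hi))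
  rw [injective_iff_map_eq_zero] at h2
  push Not at h2
  obtain ⟨y, hy, hy0⟩ := h2
  rw [h1] at hy
  have hy' : y = (1 - t) • g (R y) := by
    rw [← neg_sub, neg_smul]
    exact eq_neg_of_add_eq_zero_left hy
  have ht1 : 1 - t ≠ 0 := by
    intro h0
    rw [h0, zero_smul] at hy'
    exact hy0 hy'
  refine ⟨(1 - t)⁻¹, Module.End.hasEigenvalue_of_hasEigenvector (x := y)
    (Module.End.hasEigenvector_iff.2 ⟨Module.End.mem_eigenspace_iff.2 ?_, hy0⟩), by simp⟩
  rw [eq_inv_smul_iff₀ ht1]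
  exact hy'.symm

variable {V A : Type} {src tgt : A → V}

lemma MatRep.surjective_coboundary_of_sub {N M G : V → Type} [∀ x, Fintype (N x)]
    [∀ x, Fintype (M x)] [∀ x, DecidableEq (M x)] [∀ x, Fintype (G x)]
    {v : MatRep src tgt N} {w : MatRep src tgt G} {φ : ∀ x, Matrix (G x) (N x) ℂ}
    (hvw : v.GenericPair w) (hφ : MatRep.coboundary v w φ = 0)
    {B : ∀ x, Matrix (N x) (M x) ℂ} {L : ∀ x, Matrix (M x) (N x) ℂ} {s : MatRep src tgt M}
    (hLB : ∀ x, L x * B x = 1) (hvB : ∀ a, v a * B (src a) = B (tgt a) * s a)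
    (hB : ∀ x z, φ x *ᵥ z = 0 → B x *ᵥ (L x *ᵥ z) = z)
    (hs : Function.Surjective (MatRep.coboundary s w)) :
    Function.Surjective (MatRep.coboundary v w) := by
  intro c
  obtain ⟨ψ, hψ⟩ := hs fun a => c a * B (src a)
  let c' := c - MatRep.coboundary v w (fun x => ψ x * L x)
  have hc' : ∀ a, c' a * B (src a) = 0 := by
    intro a
    have := congrFun hψ a
    simp only [MatRep.coboundary_apply] at this
    simp only [c', Pi.sub_apply, MatRep.coboundary_apply, Matrix.sub_mul, Matrix.mul_assoc, hvB,
      hLB, Matrix.mul_one, ← this]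
    rw [← Matrix.mul_assoc (L _), hLB, Matrix.one_mul, sub_self]
  choose w' hw' using fun a => Matrix.exists_mul_eq_of_ker (P := φ (src a)) (C := c' a)
    fun z hz => by rw [← hB _ z hz, Matrix.mulVec_mulVec, hc', Matrix.zero_mulVec]
  obtain ⟨χ, hχ⟩ := hvw.mul_mem_range hφ w'
  refine ⟨χ + fun x => ψ x * L x, ?_⟩
  rw [map_add, hχ, funext hw']
  simp [c']

lemma MatRep.injective_coboundary_surjective [Fintype V] [Fintype A] {N G : V → Type}
    [∀ x, Fintype (N x)] [∀ x, Fintype (G x)] {v : MatRep src tgt N} {w : MatRep src tgt G}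
    (h : LinearMap.ker (MatRep.coboundary v w) = ⊥)
    (hd : ∑ a, Fintype.card (N (src a)) * Fintype.card (G (tgt a)) ≤
      ∑ x, Fintype.card (N x) * Fintype.card (G x)) :
    Function.Surjective (MatRep.coboundary v w) := by
  have h1 := LinearMap.ker_eq_bot.1 h
  have h2 := LinearMap.finrank_le_finrank_of_injective h1
  refine (LinearMap.injective_iff_surjective_of_finrank_eq_finrank (le_antisymm h2 ?_)).1 h1
  simpa [Module.finrank_pi_fintype, Module.finrank_matrix, mul_comm] using hd

lemma HasSubrepOfDim.refl (α : V → ℕ) : HasSubrepOfDim src tgt α α := fun _ =>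
  ⟨fun _ => ⊤, by simp, by simp⟩

lemma HasSubrepOfDim.trans {α β γ : V → ℕ} (h : HasSubrepOfDim src tgt α β)
    (h' : HasSubrepOfDim src tgt β γ) : HasSubrepOfDim src tgt α γ :=
  hasSubrepOfDim_iff.2 fun r => (hasSubrepOfDim_iff.1 h r).trans (hasSubrepOfDim_iff.1 h')

lemma HasSubrepOfDim.le {α β : V → ℕ} (h : HasSubrepOfDim src tgt α β) : β ≤ α := by
  intro x
  obtain ⟨S, hS, -⟩ := h 0
  simpa [hS] using (S x).finrank_le

lemma MatRep.exists_surjective_coboundary [Fintype V] [Fintype A] {G : V → Type}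
    [∀ x, Fintype (G x)] (w : MatRep src tgt G) (α : V → ℕ)
    (hα : ∀ β, HasSubrepOfDim src tgt α β →
      ∑ a, β (src a) * Fintype.card (G (tgt a)) ≤ ∑ x, β x * Fintype.card (G x))
    (hw : ∃ v : MatRep src tgt (fun x => Fin (α x)), v.GenericPair w) :
    ∃ v : MatRep src tgt (fun x => Fin (α x)), v.GenericPair w ∧
      Function.Surjective (MatRep.coboundary v w) := by
  induction hk : ∑ x, α x using Nat.strong_induction_on generalizing α with
  | _ k ih =>
  obtain ⟨v, hv⟩ := hw
  by_cases hker : LinearMap.ker (MatRep.coboundary v w) = ⊥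
  · exact ⟨v, hv, MatRep.injective_coboundary_surjective hker (by simpa using hα α (.refl α))⟩
  obtain ⟨φ, hφ, hφ0⟩ := (Submodule.ne_bot_iff _).1 hker
  rw [LinearMap.mem_ker] at hφ
  let S : ∀ x, Submodule ℂ (Fin (α x) → ℂ) := fun x => LinearMap.ker (φ x).mulVecLin
  have hS : ∀ x z, z ∈ S x ↔ φ x *ᵥ z = 0 := fun x z => Iff.rfl
  let β : V → ℕ := fun x => Module.finrank ℂ (S x)
  obtain ⟨B, L, s, hLB, hvB, hBS, hBL⟩ := MatRep.exists_matrices (r := v) (S := S)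
    (M := fun x => Fin (β x)) (by simp [β]) (by
      intro a z hz
      rw [hS] at hz ⊢
      have : w a * φ (src a) = φ (tgt a) * v a := sub_eq_zero.1 (congrFun hφ a)
      rw [Matrix.mulVec_mulVec, ← this, ← Matrix.mulVec_mulVec, hz, Matrix.mulVec_zero])
  have hv' : AlgebraicIndependent ℚ v.entries := hv.comp Sum.inl Sum.inl_injective
  have hαβ : HasSubrepOfDim src tgt α β := hasSubrepOfDim_iff.2
    (MatRep.HasSub.of_generic ⟨B, L, s, hLB, hvB⟩ hv')
  have hlt : ∑ x, β x < ∑ x, α x := by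
    refine Finset.sum_lt_sum (fun x _ => hαβ.le x) ?_
    by_contra! hcon
    refine hφ0 (funext fun x => ?_)
    have h1 : S x = ⊤ := Submodule.eq_top_of_finrank_eq (by
      simpa using le_antisymm (hαβ.le x) (hcon x (Finset.mem_univ x)))
    apply Matrix.ext_of_mulVec_single
    intro i
    rw [(hS x _).1 (h1 ▸ Submodule.mem_top), Pi.zero_apply, Matrix.zero_mulVec]
  obtain ⟨s₀, hs₀, hs₀'⟩ := ih _ (hk ▸ hlt) β (fun γ hγ => hα γ (hαβ.trans hγ))
    ⟨fun a i j => v a (Fin.castLE (hαβ.le _) i) (Fin.castLE (hαβ.le _) j), by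
      let ι : (Σ a, Fin (β (tgt a)) × Fin (β (src a))) → Σ a, Fin (α (tgt a)) × Fin (α (src a)) :=
        fun p => ⟨p.1, Fin.castLE (hαβ.le _) p.2.1, Fin.castLE (hαβ.le _) p.2.2⟩
      have hι : Function.Injective ι := by
        rintro ⟨a, i, j⟩ ⟨a', i', j'⟩ h
        simp only [ι, Sigma.mk.injEq] at h
        obtain ⟨rfl, h⟩ := h
        simpa using h
      have := hv.comp (Sum.map ι id) (Sum.map_injective.2 ⟨hι, Function.injective_id⟩)
      rw [Sum.elim_comp_map] at this
      exact this⟩ rfl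
  let Δ : MatRep src tgt (fun x => Fin (α x)) := fun a =>
    B (tgt a) * (s₀ a - s a) * L (src a)
  have hT₁ := AlgebraicIndependent.countable_line hv (Sum.elim Δ.entries 0)
  have hlin : ∀ t : ℂ, MatRep.coboundary (N := fun x => Fin (β x)) (fun a => s a + t • (s₀ a - s a)) w =
      MatRep.coboundary s w + t • (MatRep.coboundary s₀ w - MatRep.coboundary s w) := by
    intro t
    ext φ a : 2
    simp only [MatRep.coboundary_apply, LinearMap.add_apply, LinearMap.smul_apply,
      LinearMap.sub_apply, Pi.add_apply, Pi.smul_apply, Pi.sub_apply, Matrix.mul_add,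
      Matrix.mul_smul, Matrix.mul_sub, smul_sub]
    abel
  have hT₂ := LinearMap.finite_not_surjective_add_smul (f := MatRep.coboundary s w)
    (g := MatRep.coboundary s₀ w - MatRep.coboundary s w) (by simpa using hs₀')
  obtain ⟨t, ht⟩ := ((hT₁.union hT₂.countable).dense_compl ℂ).nonempty
  rw [Set.mem_compl_iff, Set.mem_union, not_or] at ht
  have ht₁ : MatRep.GenericPair (N := fun x => Fin (α x)) (fun a => v a + t • Δ a) w := by
    rw [MatRep.GenericPair]
    convert not_not.1 ht.1 using 1
    ext (_ | _) <;> simp [MatRep.entries]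
  have ht₂ := not_not.1 ht.2
  rw [← hlin] at ht₂
  have hφB : ∀ x, φ x * B x = 0 := fun x => by
    apply Matrix.ext_of_mulVec_single
    intro i
    rw [← Matrix.mulVec_mulVec, (hS x _).1 (hBS x _), Matrix.zero_mulVec]
  refine ⟨_, ht₁, MatRep.surjective_coboundary_of_sub (φ := φ) ht₁ ?_ hLB ?_ hBL ht₂⟩
  · rw [← hφ]
    ext1 a
    simp [Matrix.mul_add, Δ, ← Matrix.mul_assoc, hφB]
  · intro a
    simp [Matrix.mul_add, Matrix.add_mul, Δ, Matrix.mul_assoc, hLB, hvB]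

lemma hasSubrepOfDim_of_surjective [Finite V] [Finite A] {n α γ : V → ℕ} (hn : ∀ x, α x + γ x = n x)
    {v : MatRep src tgt fun x => Fin (α x)} {w : MatRep src tgt fun x => Fin (γ x)}
    (h : Function.Surjective (MatRep.coboundary v w)) : HasSubrepOfDim src tgt n α :=
  hasSubrepOfDim_iff.2 fun _ => .reindex (fun x => finSumFinEquiv.trans (finCongr (hn x)))
    (MatRep.hasSub_of_surjective h _)

end Generic

section Destabilizing

lemma Submodule.finrank_comap_mkQ {K E : Type*} [Field K] [AddCommGroup E] [Module K E]
    [FiniteDimensional K E] (S : Submodule K E) (T : Submodule K (E ⧸ S)) :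
    Module.finrank K (T.comap S.mkQ) = Module.finrank K T + Module.finrank K S := by
  have h1 : LinearMap.range (S.mkQ.domRestrict (T.comap S.mkQ)) = T := by
    rw [LinearMap.range_domRestrict, Submodule.map_comap_eq_of_surjective S.mkQ_surjective]
  have h2 : Module.finrank K (LinearMap.ker (S.mkQ.domRestrict (T.comap S.mkQ))) =
      Module.finrank K S := by
    rw [LinearMap.ker_domRestrict, Submodule.ker_mkQ]
    refine (Submodule.submoduleOfEquivOfLe fun z hz => ?_).finrank_eq
    simp [(Submodule.Quotient.mk_eq_zero S).2 hz]
  rw [← h2, ← LinearMap.finrank_range_add_finrank_ker (S.mkQ.domRestrict (T.comap S.mkQ)), h1]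

variable {V A : Type} [Fintype V] [Fintype A] {src tgt : A → V}

/-- A family of submodules minimizing a slope function, and maximal among the minimizers,
admits no nonzero morphism to its quotient; the dimension bound follows. -/
lemma exists_destabilizing_submodule {E : V → Type} [∀ x, AddCommGroup (E x)]
    [∀ x, Module ℂ (E x)] [∀ x, FiniteDimensional ℂ (E x)]
    (f : ∀ a, E (src a) →ₗ[ℂ] E (tgt a)) (γ : V → ℤ) (S₀ : ∀ x, Submodule ℂ (E x))
    (hS₀ : ∀ a, S₀ (src a) ≤ (S₀ (tgt a)).comap (f a)) :
    ∃ S : ∀ x, Submodule ℂ (E x), (∀ a, S (src a) ≤ (S (tgt a)).comap (f a)) ∧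
      ∑ x, (Module.finrank ℂ (S x) : ℤ) * γ x -
          ∑ a, (Module.finrank ℂ (S (src a)) : ℤ) * γ (tgt a) ≤
        ∑ x, (Module.finrank ℂ (S₀ x) : ℤ) * γ x -
          ∑ a, (Module.finrank ℂ (S₀ (src a)) : ℤ) * γ (tgt a) ∧
      ∑ x, (Module.finrank ℂ (S x) : ℤ) * (Module.finrank ℂ (E x) - Module.finrank ℂ (S x)) ≤
        ∑ a, (Module.finrank ℂ (S (src a)) : ℤ) *
          (Module.finrank ℂ (E (tgt a)) - Module.finrank ℂ (S (tgt a))) := by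
  classical
  let χ : (V → ℕ) → ℤ := fun d => ∑ x, (d x : ℤ) * γ x - ∑ a, (d (src a) : ℤ) * γ (tgt a)
  let dim : (∀ x, Submodule ℂ (E x)) → V → ℕ := fun S x => Module.finrank ℂ (S x)
  let I : Set (∀ x, Submodule ℂ (E x)) := {S | ∀ a, S (src a) ≤ (S (tgt a)).comap (f a)}
  have hfin : (dim '' I).Finite := by
    refine (Set.finite_Iic fun x => Module.finrank ℂ (E x)).subset ?_
    rintro _ ⟨S, -, rfl⟩ x
    exact (S x).finrank_le
  obtain ⟨_, ⟨S, hS, rfl⟩, hmin⟩ := Set.exists_min_image (dim '' I)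
    (fun d => toLex (χ d, -∑ x, (d x : ℤ))) hfin ⟨_, S₀, hS₀, rfl⟩
  have hmin' : ∀ T ∈ I, χ (dim S) < χ (dim T) ∨
      χ (dim S) = χ (dim T) ∧ ∑ x, (dim T x : ℤ) ≤ ∑ x, (dim S x : ℤ) := by
    intro T hT
    simpa [Prod.Lex.toLex_le_toLex] using hmin _ ⟨T, hT, rfl⟩
  let δ : (∀ x, S x →ₗ[ℂ] E x ⧸ S x) →ₗ[ℂ] ∀ a, S (src a) →ₗ[ℂ] E (tgt a) ⧸ S (tgt a) :=
    { toFun h a := (S (src a)).mapQ (S (tgt a)) (f a) (hS a) ∘ₗ h (src a) -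
        h (tgt a) ∘ₗ (f a).restrict (hS a)
      map_add' g h := by
        ext1 a
        simp only [Pi.add_apply, LinearMap.comp_add, LinearMap.add_comp]
        abel
      map_smul' c h := by
        ext1 a
        simp [LinearMap.comp_smul, LinearMap.smul_comp, smul_sub] }
  have hδ : Function.Injective δ := by
    rw [injective_iff_map_eq_zero]
    intro h hh
    have hh' : ∀ a (u : S (src a)), (S (src a)).mapQ (S (tgt a)) (f a) (hS a) (h (src a) u) =
        h (tgt a) ((f a).restrict (hS a) u) := fun a u =>
      sub_eq_zero.1 (DFunLike.congr_fun (congrFun hh a) u)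
    let K : ∀ x, Submodule ℂ (E x) := fun x => (LinearMap.ker (h x)).map (S x).subtype
    let T : ∀ x, Submodule ℂ (E x) := fun x => (LinearMap.range (h x)).comap (S x).mkQ
    have hK : K ∈ I := by
      rintro a _ ⟨u, hu, rfl⟩
      refine ⟨(f a).restrict (hS a) u, ?_, rfl⟩
      have hu : h (src a) u = 0 := hu
      show h (tgt a) _ = 0
      rw [← hh', hu, map_zero]
    have hT : T ∈ I := by
      rintro a y ⟨u, hu⟩
      refine ⟨(f a).restrict (hS a) u, ?_⟩
      rw [← hh', hu]
      rfl
    have hKdim : ∀ x, dim K x = Module.finrank ℂ (LinearMap.ker (h x)) := fun x =>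
      Submodule.finrank_map_subtype_eq _ _
    have hTdim : ∀ x, dim T x = Module.finrank ℂ (LinearMap.range (h x)) + dim S x := fun x =>
      Submodule.finrank_comap_mkQ _ _
    have hsum : ∀ x, (dim K x : ℤ) + dim T x = 2 * dim S x := fun x => by
      have := LinearMap.finrank_range_add_finrank_ker (h x)
      rw [hKdim, hTdim]
      simp only [dim]
      omega
    have hχ : χ (dim K) + χ (dim T) = 2 * χ (dim S) := by
      simp only [χ]
      rw [sub_add_sub_comm, ← Finset.sum_add_distrib, ← Finset.sum_add_distrib, mul_sub,
        Finset.mul_sum, Finset.mul_sum]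
      simp only [← add_mul, hsum, mul_assoc]
    have hrank : ∑ x, (Module.finrank ℂ (LinearMap.range (h x)) : ℤ) ≤ 0 := by
      have h1 := hmin' K hK
      have h2 := hmin' T hT
      have h3 : ∑ x, (dim T x : ℤ) ≤ ∑ x, (dim S x : ℤ) := by
        rcases h2 with h2 | h2
        · omega
        · exact h2.2
      simp only [hTdim, Nat.cast_add, Finset.sum_add_distrib] at h3
      linarith
    ext1 x
    have h1 := (Finset.sum_eq_zero_iff_of_nonneg fun x _ => by positivity).1
      (le_antisymm hrank (Finset.sum_nonneg fun x _ => by positivity)) x (Finset.mem_univ x)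
    exact LinearMap.range_eq_bot.1 (Submodule.finrank_eq_zero.1 (by exact_mod_cast h1))
  refine ⟨S, hS, ?_, ?_⟩
  · rcases hmin' S₀ hS₀ with h | h
    · exact h.le
    · exact h.1.le
  · have h1 := LinearMap.finrank_le_finrank_of_injective hδ
    simp only [Module.finrank_pi_fintype, Module.finrank_linearMap] at h1
    have hq : ∀ x, (Module.finrank ℂ (E x ⧸ S x) : ℤ) =
        Module.finrank ℂ (E x) - Module.finrank ℂ (S x) := fun x => by
      have := (S x).finrank_quotient_add_finrank
      omega
    zify at h1
    simpa only [hq] using h1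

/-- If `α` is not a generic subdimension vector of `α + γ`, some generic subdimension vector `β`
of `α` pairs negatively with `γ` and nonpositively with `α - β`. -/
lemma exists_destabilizing_dim {n α γ : V → ℕ} (hn : ∀ x, α x + γ x = n x)
    (h : ¬ HasSubrepOfDim src tgt n α) :
    ∃ β : V → ℕ, HasSubrepOfDim src tgt α β ∧
      ∑ x, (β x : ℤ) * γ x - ∑ a, (β (src a) : ℤ) * γ (tgt a) < 0 ∧
      ∑ x, (β x : ℤ) * (α x - β x) ≤ ∑ a, (β (src a) : ℤ) * (α (tgt a) - β (tgt a)) := by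
  obtain ⟨z, hz⟩ := exists_algebraicIndependent
    ((Σ a : A, Fin (α (tgt a)) × Fin (α (src a))) ⊕ (Σ a : A, Fin (γ (tgt a)) × Fin (γ (src a))))
  let v : MatRep src tgt fun x => Fin (α x) := fun a i j => z (Sum.inl ⟨a, i, j⟩)
  let w : MatRep src tgt fun x => Fin (γ x) := fun a i j => z (Sum.inr ⟨a, i, j⟩)
  have hvw : v.GenericPair w := by
    rwa [← Sum.elim_comp_inl_inr z] at hz
  have hv : AlgebraicIndependent ℚ v.entries := hvw.comp Sum.inl Sum.inl_injective
  obtain ⟨β₀, hβ₀, hlt⟩ : ∃ β₀, HasSubrepOfDim src tgt α β₀ ∧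
      ∑ x, β₀ x * γ x < ∑ a, β₀ (src a) * γ (tgt a) := by
    by_contra! hcon
    obtain ⟨v', -, hv'⟩ := MatRep.exists_surjective_coboundary w α (by simpa using hcon) ⟨v, hvw⟩
    exact h (hasSubrepOfDim_of_surjective hn hv')
  obtain ⟨S₀, hdim, hS₀⟩ := (hasSubrepOfDim_iff.1 hβ₀ v).exists_submodule
  obtain ⟨S, hS, hχ, hle⟩ := exists_destabilizing_submodule (fun a => (v a).mulVecLin)
    (fun x => (γ x : ℤ)) S₀ hS₀
  refine ⟨fun x => Module.finrank ℂ (S x), hasSubrepOfDim_iff.2 (MatRep.HasSub.of_generic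
    (MatRep.hasSub_of_submodule (S := S) (by simp) hS) hv), hχ.trans_lt ?_, by simpa using hle⟩
  simp only [hdim, Fintype.card_fin]
  exact sub_neg.2 (by exact_mod_cast hlt)

end Destabilizing

/-- Schofield/BVW criterion for subdimension vectors.
For a finite acyclic quiver and a subdimension vector `α` of `n`, one has `α ≤_Q n`
iff `edim_Q(α,n) ≥ 0` and every `β <_Q α` satisfies `β <_Q n`. -/
theorem schofield_subdimension_criterion
    {V A : Type} [Fintype V] [Fintype A] (src tgt : A → V)
    (hacyc : NoCycles src tgt) (n α : V → ℕ) (hsub : ∀ x : V, α x ≤ n x) :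
    HasSubrepOfDim src tgt n α ↔
      (0 ≤ (∑ x : V, (α x : ℤ) * ((n x : ℤ) - (α x : ℤ))) -
          ∑ a : A, (α (src a) : ℤ) * ((n (tgt a) : ℤ) - (α (tgt a) : ℤ))) ∧
      (∀ β : V → ℕ, (HasSubrepOfDim src tgt α β ∧ β ≠ α) →
        (HasSubrepOfDim src tgt n β ∧ β ≠ n)) := by
  constructor
  · refine fun h => ⟨h.edim_nonneg, fun β hβ => ⟨h.trans hβ.1, ?_⟩⟩
    rintro rfl
    exact hβ.2 (le_antisymm hβ.1.le hsub)
  · rintro ⟨h0, h1⟩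
    by_contra h
    obtain ⟨β, hβ, hlt, hle⟩ := exists_destabilizing_dim (γ := fun x => n x - α x)
      (fun x => Nat.add_sub_cancel' (hsub x)) h
    simp only [Nat.cast_sub (hsub _)] at hlt
    have hne : β ≠ α := by
      rintro rfl
      exact hlt.not_ge h0
    have h2 := (h1 β ⟨hβ, hne⟩).1.edim_nonneg
    have e : ∀ x y, (β x : ℤ) * ((n y : ℤ) - β y) =
        (β x : ℤ) * ((n y : ℤ) - α y) + (β x : ℤ) * ((α y : ℤ) - β y) := fun _ _ => by ring
    simp only [e, Finset.sum_add_distrib] at h2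
    linarith
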